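/- arXiv:1508.04353 — 3 statements merged into one kernel-verified Lean document; each statement's English description precedes it below -/
import Mathlib

section
/- Let k be an algebraically closed field and A a spectroid over k. Then every indecomposable module M in mod A has a local endomorphism ring, i.e., End(M) is a local ring. -/
open CategoryTheory CategoryTheory.Limits

namespace Paper

variable (k : Type) [Field k]

section General

variable (A : Type) [Category.{0} A] [Preadditive A] [CategoryTheory.Linear k A]

/-- A spectroid over `k`: a (small) Hom-finite `k`-linear category in which every object
has a local endomorphism ring and distinct objects are not isomorphic. -/
class Spectroid : Prop where
  homFinite : ∀ a b : A, FiniteDimensional k (a ⟶ b)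
  localEnd : ∀ a : A, IsLocalRing (End a)
  skeletal : ∀ a b : A, (a ≅ b) → a = b

variable {A}

/-- `M` is a module over `A`, i.e. the functor `M : A ⥤ ModuleCat k` is additive and
`k`-linear on morphisms. -/
def IsMod (M : A ⥤ ModuleCat.{0} k) : Prop :=
  (∀ {a b : A} (f g : a ⟶ b), M.map (f + g) = M.map f + M.map g) ∧
  (∀ {a b : A} (r : k) (f : a ⟶ b), M.map (r • f) = r • M.map f)

/-- `M` is a locally finite dimensional module over `A`, i.e. an object of `mod A`. -/
def IsLfdMod (M : A ⥤ ModuleCat.{0} k) : Prop :=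
  IsMod k M ∧ ∀ a : A, FiniteDimensional k (M.obj a)

/-- The projective module `P_a = Hom_A(a, -)` at an object `a`. -/
noncomputable def ProjAt (a : A) : A ⥤ ModuleCat.{0} k :=
  (linearCoyoneda k A).obj (Opposite.op a)

/-- The injective module `I_a = D Hom_A(-, a)` at an object `a`. -/
noncomputable def InjAt (a : A) : A ⥤ ModuleCat.{0} k where
  obj b := ModuleCat.of k (Module.Dual k (b ⟶ a))
  map {b c} f := ModuleCat.ofHom (LinearMap.dualMap (Linear.leftComp k a f))
  map_id b := by
    have h : Linear.leftComp k a (𝟙 b) = LinearMap.id := by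
      apply LinearMap.ext; intro g; simp
    rw [h, LinearMap.dualMap_id]; rfl
  map_comp {b c d} f g := by
    have h : Linear.leftComp k a (f ≫ g) =
        (Linear.leftComp k a f).comp (Linear.leftComp k a g) := by
      apply LinearMap.ext; intro h; simp
    rw [h]; rfl

instance : HasFiniteBiproducts (A ⥤ ModuleCat.{0} k) :=
  CategoryTheory.Abelian.hasFiniteBiproducts

/-- `M` is finitely generated: there is an epimorphism `⊕_{i=1}^r P_{a_i} → M`. -/
def IsFG (M : A ⥤ ModuleCat.{0} k) : Prop :=
  ∃ (r : ℕ) (a : Fin r → A) (f : (⨁ fun i => ProjAt k (a i)) ⟶ M), Epi f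

/-- `M` is finitely presented: there is an epimorphism `⊕_{i=1}^r P_{a_i} → M` with
finitely generated kernel. -/
def IsFP (M : A ⥤ ModuleCat.{0} k) : Prop :=
  ∃ (r : ℕ) (a : Fin r → A) (f : (⨁ fun i => ProjAt k (a i)) ⟶ M),
    Epi f ∧ IsFG k (kernel f)

/-- `M` is finitely co-generated: there is a monomorphism `M → ⊕_{j=1}^s I_{b_j}`. -/
def IsFCG (M : A ⥤ ModuleCat.{0} k) : Prop :=
  ∃ (s : ℕ) (b : Fin s → A) (f : M ⟶ ⨁ fun j => InjAt k (b j)), Mono f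

/-- `M` is finitely co-presented: there is a monomorphism `M → ⊕_{j=1}^s I_{b_j}` with
finitely co-generated cokernel. -/
def IsFCP (M : A ⥤ ModuleCat.{0} k) : Prop :=
  ∃ (s : ℕ) (b : Fin s → A) (f : M ⟶ ⨁ fun j => InjAt k (b j)),
    Mono f ∧ IsFCG k (cokernel f)

/-- `f` is an irreducible morphism in `mod A`: it is neither a split mono nor a split epi,
and in any factorization `f = g ≫ h` through an object of `mod A`, `g` is a split mono
or `h` is a split epi. -/
def Irred {L M : A ⥤ ModuleCat.{0} k} (f : L ⟶ M) : Prop :=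
  ¬ IsSplitMono f ∧ ¬ IsSplitEpi f ∧
    ∀ ⦃X : A ⥤ ModuleCat.{0} k⦄, IsLfdMod k X →
      ∀ (g : L ⟶ X) (h : X ⟶ M), g ≫ h = f → IsSplitMono g ∨ IsSplitEpi h

/-- `M` is an indecomposable object of `mod A`: it is nonzero, and whenever `M ≅ X ⊞ Y`
with `X`, `Y` in `mod A`, one of `X`, `Y` is zero. -/
def Indec (M : A ⥤ ModuleCat.{0} k) : Prop :=
  ¬ IsZero M ∧ ∀ ⦃X Y : A ⥤ ModuleCat.{0} k⦄, IsLfdMod k X → IsLfdMod k Y →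
    (M ≅ X ⊞ Y) → IsZero X ∨ IsZero Y

/-- `0 → L →f M →g N → 0` is an almost split sequence in `mod A`. -/
structure AlmostSplitSeq {L M N : A ⥤ ModuleCat.{0} k} (f : L ⟶ M) (g : M ⟶ N) : Prop where
  mono : Mono f
  epi : Epi g
  zero : f ≫ g = 0
  exact : (ShortComplex.mk f g zero).Exact
  not_splitMono : ¬ IsSplitMono f
  not_splitEpi : ¬ IsSplitEpi g
  left_almost_split : ∀ ⦃X : A ⥤ ModuleCat.{0} k⦄, IsLfdMod k X →
    ∀ u : L ⟶ X, ¬ IsSplitMono u → ∃ v : M ⟶ X, f ≫ v = u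
  right_almost_split : ∀ ⦃X : A ⥤ ModuleCat.{0} k⦄, IsLfdMod k X →
    ∀ u : X ⟶ N, ¬ IsSplitEpi u → ∃ v : X ⟶ M, v ≫ g = u

/-- `M` is projective as an object of `mod A`. -/
def ProjInMod (M : A ⥤ ModuleCat.{0} k) : Prop :=
  ∀ ⦃X Y : A ⥤ ModuleCat.{0} k⦄, IsLfdMod k X → IsLfdMod k Y →
    ∀ (e : X ⟶ Y), Epi e → ∀ u : M ⟶ Y, ∃ t : M ⟶ X, t ≫ e = u

/-- `M` is injective as an object of `mod A`. -/
def InjInMod (M : A ⥤ ModuleCat.{0} k) : Prop :=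
  ∀ ⦃X Y : A ⥤ ModuleCat.{0} k⦄, IsLfdMod k X → IsLfdMod k Y →
    ∀ (m : X ⟶ Y), Mono m → ∀ u : X ⟶ M, ∃ t : Y ⟶ M, m ≫ t = u

/-- `h` is a (nonempty) composition of irreducible morphisms between indecomposable
objects of `mod A`. -/
inductive IrredChain : ∀ {X Y : A ⥤ ModuleCat.{0} k}, (X ⟶ Y) → Prop
  | single {X Y : A ⥤ ModuleCat.{0} k} (f : X ⟶ Y) :
      IsLfdMod k X → Indec k X → IsLfdMod k Y → Indec k Y → Irred k f → IrredChain f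
  | comp {X Y Z : A ⥤ ModuleCat.{0} k} (f : X ⟶ Y) (g : Y ⟶ Z) :
      IsLfdMod k X → Indec k X → Irred k f → IrredChain g → IrredChain (f ≫ g)

end General

section QuiverSection

variable (Q : Type) [Quiver.{0} Q]

/-- `Q` is locally finite: every vertex is the source of finitely many arrows and the
target of finitely many arrows. -/
def LocallyFinite : Prop :=
  ∀ x : Q, Finite (Σ y : Q, x ⟶ y) ∧ Finite (Σ y : Q, y ⟶ x)

/-- `Q` is interval finite: there are finitely many paths between any two vertices. -/
def IntervalFinite : Prop :=
  ∀ x y : Q, Finite (Quiver.Path x y)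

/-- `Q` is strongly locally finite: locally finite and interval finite. -/
def StronglyLocallyFinite : Prop :=
  LocallyFinite Q ∧ IntervalFinite Q

/-- `Q` is connected: nonempty, and any two vertices are joined by a walk. -/
def QuiverConnected : Prop :=
  Nonempty Q ∧ ∀ x y : Q,
    Nonempty (Quiver.Path (Quiver.Symmetrify.of.obj x) (Quiver.Symmetrify.of.obj y))

/-- The path category `kQ` of the quiver `Q`: the free `k`-linear category on the free
category on `Q`. -/
abbrev PathCat := CategoryTheory.Free k (Paths Q)

/-- A vertex of `Q`, seen as an object of the path category `kQ`. -/
noncomputable def vtx (x : Q) : PathCat k Q :=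
  (Free.embedding k (Paths Q)).obj ((Paths.of Q).obj x)

/-- An arrow of `Q`, seen as a morphism of the path category `kQ`. -/
noncomputable def arrHom {x y : Q} (α : x ⟶ y) : vtx k Q x ⟶ vtx k Q y :=
  (Free.embedding k (Paths Q)).map ((Paths.of Q).map α)

/-- The degree of a vertex of `Q`: the total number of arrows incident to it. -/
noncomputable def degree (x : Q) : ℕ :=
  Nat.card ((Σ y : Q, x ⟶ y) ⊕ (Σ y : Q, y ⟶ x))

/-- `M` belongs to `rrep(Q)`: it is the middle term of a short exact sequence
`0 → L → M → N → 0` with `L` finitely presented, `N` finitely co-presented, and only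
finitely many arrows `α` of `Q` satisfy `M(α) ≠ 0`, `L(α) = 0` and `N(α) = 0`. -/
def InRrep (M : PathCat k Q ⥤ ModuleCat.{0} k) : Prop :=
  ∃ (L N : PathCat k Q ⥤ ModuleCat.{0} k) (f : L ⟶ M) (g : M ⟶ N) (zero : f ≫ g = 0),
    Mono f ∧ Epi g ∧ (ShortComplex.mk f g zero).Exact ∧ IsFP k L ∧ IsFCP k N ∧
    Set.Finite {p : Σ (x : Q) (y : Q), x ⟶ y |
      M.map (arrHom k Q p.2.2) ≠ 0 ∧ L.map (arrHom k Q p.2.2) = 0 ∧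
      N.map (arrHom k Q p.2.2) = 0}

variable {Q}

/-- The vertices occurring in a path. -/
def InPath {x : Q} : ∀ {y : Q}, Quiver.Path x y → Q → Prop
  | _, Quiver.Path.nil, v => v = x
  | _, @Quiver.Path.cons _ _ _ _ c p _, v => v = c ∨ InPath p v

variable (Q)

/-- `Q` is a star quiver: it is obtained from a finite full convex subquiver `Γ` by
attaching finitely many rays and co-rays with no common vertices. -/
def IsStarQuiver : Prop :=
  ∃ (Γ S₁ S₂ : Set Q) (v : Q → ℕ → Q),
    Γ.Finite ∧ S₁ ⊆ Γ ∧ S₂ ⊆ Γ ∧ Disjoint S₁ S₂ ∧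
    (∀ x y : Q, x ∈ Γ → y ∈ Γ → ∀ p : Quiver.Path x y, ∀ z : Q, InPath p z → z ∈ Γ) ∧
    (∀ s ∈ S₁ ∪ S₂, ∀ i : ℕ, v s i ∉ Γ) ∧
    (∀ s ∈ S₁ ∪ S₂, ∀ t ∈ S₁ ∪ S₂, ∀ i j : ℕ, v s i = v t j → s = t ∧ i = j) ∧
    (∀ x : Q, x ∉ Γ → ∃ s ∈ S₁ ∪ S₂, ∃ i : ℕ, x = v s i) ∧
    (∀ s ∈ S₁, Nat.card (s ⟶ v s 0) = 1 ∧ ∀ i : ℕ, Nat.card (v s i ⟶ v s (i + 1)) = 1) ∧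
    (∀ s ∈ S₂, Nat.card (v s 0 ⟶ s) = 1 ∧ ∀ i : ℕ, Nat.card (v s (i + 1) ⟶ v s i) = 1) ∧
    (∀ x y : Q, (x ⟶ y) → ¬(x ∈ Γ ∧ y ∈ Γ) →
      (∃ s ∈ S₁, (x = s ∧ y = v s 0) ∨ ∃ i : ℕ, x = v s i ∧ y = v s (i + 1)) ∨
      (∃ s ∈ S₂, (x = v s 0 ∧ y = s) ∨ ∃ i : ℕ, x = v s (i + 1) ∧ y = v s i))

end QuiverSection

section Fitting

variable {k}
variable {A : Type} [Category.{0} A]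

/-- The subfunctor of `M` given by a family of subspaces stable under all `M.map f`. -/
noncomputable def subfunctor (M : A ⥤ ModuleCat.{0} k) (N : ∀ a, Submodule k (M.obj a))
    (hN : ∀ {a b : A} (f : a ⟶ b), N a ≤ (N b).comap (M.map f).hom) :
    A ⥤ ModuleCat.{0} k where
  obj a := ModuleCat.of k (N a)
  map f := ModuleCat.ofHom ((M.map f).hom.restrict (hN f))
  map_id a := by
    ext x
    exact ConcreteCategory.congr_hom (M.map_id a) x.1
  map_comp f g := by
    ext x
    exact ConcreteCategory.congr_hom (M.map_comp f g) x.1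

/-- The inclusion of a subfunctor. -/
noncomputable def subfunctorInclusion (M : A ⥤ ModuleCat.{0} k)
    (N : ∀ a, Submodule k (M.obj a))
    (hN : ∀ {a b : A} (f : a ⟶ b), N a ≤ (N b).comap (M.map f).hom) :
    subfunctor M N hN ⟶ M where
  app a := ModuleCat.ofHom (N a).subtype
  naturality a b f := by
    ext x
    rfl

/-- The projection onto a subfunctor along a complementary one. -/
noncomputable def subfunctorProjection (M : A ⥤ ModuleCat.{0} k)
    (N N' : ∀ a, Submodule k (M.obj a))
    (hN : ∀ {a b : A} (f : a ⟶ b), N a ≤ (N b).comap (M.map f).hom)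
    (hN' : ∀ {a b : A} (f : a ⟶ b), N' a ≤ (N' b).comap (M.map f).hom)
    (hc : ∀ a, IsCompl (N a) (N' a)) :
    M ⟶ subfunctor M N hN where
  app a := ModuleCat.ofHom ((N a).projectionOnto (N' a) (hc a))
  naturality a b f := by
    ext x
    obtain ⟨y, hy, z, hz, rfl⟩ := Submodule.mem_sup.mp
      ((hc a).sup_eq_top ▸ Submodule.mem_top : x ∈ N a ⊔ N' a)
    have h₁ := (N a).projectionOnto_apply_left (hc a) ⟨y, hy⟩
    have h₂ := (N a).projectionOnto_apply_right (hc a) ⟨z, hz⟩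
    have h₃ := (N b).projectionOnto_apply_left (hc b) ⟨_, hN f hy⟩
    have h₄ := (N b).projectionOnto_apply_right (hc b) ⟨_, hN' f hz⟩
    change (N b).projectionOnto (N' b) (hc b) ((M.map f).hom (y + z)) =
      (M.map f).hom.restrict (hN f) ((N a).projectionOnto (N' a) (hc a) (y + z))
    rw [map_add, map_add, map_add, h₁, h₂, h₃, h₄, map_add, map_zero]
    rfl

/-- A module is the biproduct of two complementary subfunctors. -/
noncomputable def isoBiprodSubfunctor (M : A ⥤ ModuleCat.{0} k)
    (N N' : ∀ a, Submodule k (M.obj a))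
    (hN : ∀ {a b : A} (f : a ⟶ b), N a ≤ (N b).comap (M.map f).hom)
    (hN' : ∀ {a b : A} (f : a ⟶ b), N' a ≤ (N' b).comap (M.map f).hom)
    (hc : ∀ a, IsCompl (N a) (N' a)) :
    M ≅ subfunctor M N hN ⊞ subfunctor M N' hN' :=
  biprod.uniqueUpToIso _ _ (b :=
    { pt := M
      fst := subfunctorProjection M N N' hN hN' hc
      snd := subfunctorProjection M N' N hN' hN fun a => (hc a).symm
      inl := subfunctorInclusion M N hN
      inr := subfunctorInclusion M N' hN'
      inl_fst := by
        ext a x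
        exact (N a).projectionOnto_apply_left (hc a) x
      inl_snd := by
        ext a x
        exact (N' a).projectionOnto_apply_right (hc a).symm x
      inr_fst := by
        ext a x
        exact (N a).projectionOnto_apply_right (hc a) x
      inr_snd := by
        ext a x
        exact (N' a).projectionOnto_apply_left (hc a).symm x })
    (isBinaryBilimitOfTotal _ (by
      ext a x
      exact Submodule.projection_add_projection_eq_self (hc a) x))

theorem eq_bot_of_isZero_subfunctor {M : A ⥤ ModuleCat.{0} k}
    {N : ∀ a, Submodule k (M.obj a)}
    {hN : ∀ {a b : A} (f : a ⟶ b), N a ≤ (N b).comap (M.map f).hom}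
    (h : IsZero (subfunctor M N hN)) (a : A) : N a = ⊥ := by
  have := ModuleCat.subsingleton_of_isZero (h.obj a)
  exact Submodule.subsingleton_iff_eq_bot.mp this

theorem isUnit_end_of_injective {M : A ⥤ ModuleCat.{0} k}
    [∀ a, FiniteDimensional k (M.obj a)] (φ : End M)
    (h : ∀ a, Function.Injective (NatTrans.app φ a).hom) : IsUnit φ := by
  rw [isUnit_iff_isIso]
  have (a : A) : IsIso (NatTrans.app φ a) := by
    rw [ConcreteCategory.isIso_iff_bijective]
    exact ⟨h a, LinearMap.injective_iff_surjective.mp (h a)⟩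
  exact NatIso.isIso_of_isIso_app φ

theorem map_app_pow {M : A ⥤ ModuleCat.{0} k} (φ : M ⟶ M) {a b : A} (f : a ⟶ b) (n : ℕ)
    (x : M.obj a) :
    (M.map f).hom (((φ.app a).hom ^ n) x) = ((φ.app b).hom ^ n) ((M.map f).hom x) := by
  induction n generalizing x with
  | zero => rfl
  | succ n ih =>
    rw [pow_succ, pow_succ, Module.End.mul_apply, Module.End.mul_apply, ih]
    congr 1
    exact (ConcreteCategory.congr_hom (φ.naturality f) x).symm

variable [Preadditive A] [CategoryTheory.Linear k A]

theorem isLfdMod_subfunctor {M : A ⥤ ModuleCat.{0} k} (hM : IsLfdMod k M)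
    (N : ∀ a, Submodule k (M.obj a))
    (hN : ∀ {a b : A} (f : a ⟶ b), N a ≤ (N b).comap (M.map f).hom) :
    IsLfdMod k (subfunctor M N hN) := by
  refine ⟨⟨fun f g => ?_, fun r f => ?_⟩, fun a => ?_⟩
  · ext x
    apply Subtype.ext
    exact ConcreteCategory.congr_hom (hM.1.1 f g) x.1
  · ext x
    apply Subtype.ext
    exact ConcreteCategory.congr_hom (hM.1.2 r f) x.1
  · have := hM.2 a
    exact inferInstanceAs (FiniteDimensional k (N a))

/-- Fitting's lemma for an endomorphism of an indecomposable locally finite dimensional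
module. -/
theorem isUnit_or_isUnit_one_sub_of_indec {M : A ⥤ ModuleCat.{0} k} (hM : IsLfdMod k M)
    (hMind : Indec k M) (φ : End M) : IsUnit φ ∨ IsUnit (1 - φ) := by
  have := hM.2
  let u (a : A) : Module.End k (M.obj a) := (NatTrans.app φ a).hom
  have hK {a b : A} (f : a ⟶ b) :
      (⨆ n, LinearMap.ker (u a ^ n)) ≤ (⨆ n, LinearMap.ker (u b ^ n)).comap (M.map f).hom := by
    refine iSup_le fun n x hx => Submodule.mem_iSup_of_mem n ?_
    rw [LinearMap.mem_ker] at hx ⊢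
    rw [← map_app_pow φ f n x, hx, map_zero]
  have hR {a b : A} (f : a ⟶ b) :
      (⨅ n, LinearMap.range (u a ^ n)) ≤
        (⨅ n, LinearMap.range (u b ^ n)).comap (M.map f).hom := by
    intro x hx
    rw [Submodule.mem_comap, Submodule.mem_iInf]
    intro n
    obtain ⟨y, rfl⟩ := Submodule.mem_iInf _ |>.mp hx n
    exact ⟨(M.map f).hom y, (map_app_pow φ f n y).symm⟩
  rcases hMind.2 (isLfdMod_subfunctor hM _ hK) (isLfdMod_subfunctor hM _ hR)
    (isoBiprodSubfunctor M _ _ hK hR fun a =>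
      (u a).isCompl_iSup_ker_pow_iInf_range_pow) with h | h
  · refine Or.inl (isUnit_end_of_injective φ fun a => LinearMap.ker_eq_bot.mp ?_)
    rw [eq_bot_iff, ← eq_bot_of_isZero_subfunctor h a]
    exact le_iSup_of_le 1 (by rw [pow_one])
  · refine Or.inr (isUnit_end_of_injective _ fun a => LinearMap.ker_eq_bot.mp ?_)
    rw [eq_bot_iff, ← eq_bot_of_isZero_subfunctor h a]
    intro x hx
    have hx' : x = u a x := sub_eq_zero.mp hx
    rw [Submodule.mem_iInf]
    intro n
    refine ⟨x, ?_⟩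
    induction n with
    | zero => rfl
    | succ n ih => rw [pow_succ, Module.End.mul_apply, ← hx', ih]

end Fitting

variable (k : Type) [Field k] [IsAlgClosed k]
variable (A : Type) [Category.{0} A] [Preadditive A] [CategoryTheory.Linear k A]

/-- Every indecomposable module in `mod A` over a spectroid `A` has a local
endomorphism ring. -/
theorem statement_0 [Spectroid k A] (M : A ⥤ ModuleCat.{0} k)
    (hM : IsLfdMod k M) (hMind : Indec k M) :
    IsLocalRing (End M) := by
  have : Nontrivial (End M) :=
    ⟨1, 0, fun h => hMind.1 ((IsZero.iff_id_eq_zero M).mpr h)⟩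
  refine ⟨fun {φ ψ} h => ?_⟩
  rw [← eq_sub_iff_add_eq'] at h
  exact h ▸ isUnit_or_isUnit_one_sub_of_indec hM hMind φ

end Paper
end

section
/- Let k be an algebraically closed field, Q an interval finite quiver and A = kQ its path category. Then every simple module in Mod A is finitely presented and finitely co-presented if and only if Q is locally finite. -/
open CategoryTheory CategoryTheory.Limits

namespace Paper

variable (k : Type) [Field k]

section Yoneda

variable {k} {A : Type} [Category.{0} A] [Preadditive A]
  [CategoryTheory.Linear k A]

theorem IsMod.map_zero {M : A ⥤ ModuleCat.{0} k} (hM : IsMod k M) (a b : A) :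
    M.map (0 : a ⟶ b) = 0 := by
  simpa using hM.2 (0 : k) (0 : a ⟶ b)

/-- The morphism `P_a ⟶ M` sending the identity of `a` to `m`. -/
noncomputable def projHom {M : A ⥤ ModuleCat.{0} k} (hM : IsMod k M) {a : A} (m : M.obj a) :
    ProjAt k a ⟶ M where
  app b := ModuleCat.ofHom
    (X := (a ⟶ b)) (Y := M.obj b)
    { toFun := fun f => M.map f m
      map_add' := fun f g => by rw [hM.1]; rfl
      map_smul' := fun r f => by rw [hM.2]; rfl }
  naturality b c g := by
    ext f
    exact congrArg (fun h => h.hom m) (M.map_comp (f : a ⟶ b) g)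

theorem projHom_app {M : A ⥤ ModuleCat.{0} k} (hM : IsMod k M) {a b : A} (m : M.obj a)
    (f : a ⟶ b) : ((projHom hM m).app b).hom f = (M.map f).hom m := rfl

theorem proj_app_apply {M : A ⥤ ModuleCat.{0} k} {a b : A} (g : ProjAt k a ⟶ M) (f : a ⟶ b) :
    (g.app b).hom f = (M.map f).hom ((g.app a).hom (𝟙 a : a ⟶ a)) := by
  have h := congrArg (fun h => h.hom (𝟙 a : a ⟶ a)) (g.naturality f)
  refine Eq.trans ?_ h
  change _ = (g.app b).hom ((𝟙 a : a ⟶ a) ≫ f)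
  rw [Category.id_comp]

theorem projHom_ext {M : A ⥤ ModuleCat.{0} k} {a : A} {g g' : ProjAt k a ⟶ M}
    (h : (g.app a).hom (𝟙 a : a ⟶ a) = (g'.app a).hom (𝟙 a : a ⟶ a)) : g = g' := by
  ext b f
  exact (proj_app_apply g f).trans ((congrArg _ h).trans (proj_app_apply g' f).symm)

theorem isMod_projAt (a : A) : IsMod k (ProjAt k a) := by
  constructor
  · intro b c f g
    ext h
    exact Preadditive.comp_add _ _ _ h f g
  · intro b c r f
    ext h
    exact Linear.comp_smul _ _ _ h r f

/-- The morphism `M ⟶ I_a` induced by a linear form on `M(a)`. -/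
noncomputable def injHom {M : A ⥤ ModuleCat.{0} k} (hM : IsMod k M) {a : A}
    (φ : M.obj a →ₗ[k] k) : M ⟶ InjAt k a where
  app b := ModuleCat.ofHom (X := M.obj b) (Y := Module.Dual k (b ⟶ a))
    (LinearMap.mk₂ k (fun m (f : b ⟶ a) => φ ((M.map f).hom m))
      (fun m m' f => by simp) (fun r m f => by simp)
      (fun m f g => by rw [hM.1]; simp) (fun r m f => by rw [hM.2]; simp))
  naturality b c g := by
    ext m
    refine LinearMap.ext fun (f : c ⟶ a) => ?_
    exact congrArg (fun h => φ (h.hom m)) (M.map_comp g f).symm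

/-- Evaluation of an element of `I_a(b)` at a morphism `b ⟶ a`. -/
noncomputable def injEval {a b : A} (f : b ⟶ a) : (InjAt k a).obj b →ₗ[k] k :=
  LinearMap.applyₗ (R := k) (M := (b ⟶ a)) (M₂ := k) f

theorem injEval_map {a b c : A} (g : b ⟶ c) (f : c ⟶ a) (ξ : (InjAt k a).obj b) :
    injEval f (((InjAt k a).map g).hom ξ) = injEval (g ≫ f) ξ := rfl

theorem inj_ext {a b : A} {ξ ξ' : (InjAt k a).obj b}
    (h : ∀ f : b ⟶ a, injEval f ξ = injEval f ξ') : ξ = ξ' :=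
  LinearMap.ext (f := (show Module.Dual k (b ⟶ a) from ξ)) h

theorem injEval_app {M : A ⥤ ModuleCat.{0} k} {a b : A} (g : M ⟶ InjAt k a) (f : b ⟶ a)
    (m : M.obj b) :
    injEval f ((g.app b).hom m) = injEval (𝟙 a) ((g.app a).hom ((M.map f).hom m)) := by
  have h := congrArg (fun h => injEval (𝟙 a) (h.hom m)) (g.naturality f)
  refine Eq.trans ?_ h.symm
  change _ = injEval (𝟙 a) (((InjAt k a).map f).hom ((g.app b).hom m))
  rw [injEval_map, Category.comp_id]

theorem injEval_injHom {M : A ⥤ ModuleCat.{0} k} (hM : IsMod k M) {a b : A}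
    (φ : M.obj a →ₗ[k] k) (m : M.obj b) (f : b ⟶ a) :
    injEval f (((injHom hM φ).app b).hom m) = φ ((M.map f).hom m) := rfl

theorem injHom_ext {M : A ⥤ ModuleCat.{0} k} {a : A} {g g' : M ⟶ InjAt k a}
    (h : ∀ m : M.obj a, injEval (𝟙 a) ((g.app a).hom m) = injEval (𝟙 a) ((g'.app a).hom m)) :
    g = g' := by
  ext b m
  refine inj_ext fun f => ?_
  exact (injEval_app g f m).trans ((h _).trans (injEval_app g' f m).symm)

theorem isMod_injAt (a : A) : IsMod k (InjAt k a) := by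
  constructor
  · intro b c f g
    ext ξ
    refine inj_ext fun h => ?_
    change injEval h (((InjAt k a).map (f + g)).hom ξ) = injEval h (((InjAt k a).map f).hom ξ)
      + injEval h (((InjAt k a).map g).hom ξ)
    simp only [injEval_map, Preadditive.add_comp]
    exact map_add (show Module.Dual k (b ⟶ a) from ξ) _ _
  · intro b c r f
    ext ξ
    refine inj_ext fun h => ?_
    change injEval h (((InjAt k a).map (r • f)).hom ξ) =
      r • injEval h (((InjAt k a).map f).hom ξ)
    simp only [injEval_map, Linear.smul_comp]
    exact map_smul (show Module.Dual k (b ⟶ a) from ξ) _ _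

end Yoneda

section Finiteness

variable {k} {A : Type} [Category.{0} A] [Preadditive A]
  [CategoryTheory.Linear k A]

theorem isFG_of_finite {M : A ⥤ ModuleCat.{0} k} {ι : Type} [Finite ι] (a : ι → A)
    (φ : ∀ i, ProjAt k (a i) ⟶ M)
    (h : ∀ {N : A ⥤ ModuleCat.{0} k} (g g' : M ⟶ N), (∀ i, φ i ≫ g = φ i ≫ g') → g = g') :
    IsFG k M := by
  obtain ⟨n, ⟨e⟩⟩ := Finite.exists_equiv_fin ι
  refine ⟨n, fun i => a (e.symm i), biproduct.desc fun i => φ (e.symm i), ⟨fun g g' hg => ?_⟩⟩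
  refine h g g' fun i => ?_
  have := congrArg (fun f => biproduct.ι (fun i => ProjAt k (a (e.symm i))) (e i) ≫ f) hg
  simp only [biproduct.ι_desc_assoc] at this
  rwa [e.symm_apply_apply] at this

theorem isFCG_of_finite {M : A ⥤ ModuleCat.{0} k} {ι : Type} [Finite ι] (a : ι → A)
    (φ : ∀ i, M ⟶ InjAt k (a i))
    (h : ∀ {N : A ⥤ ModuleCat.{0} k} (g g' : N ⟶ M), (∀ i, g ≫ φ i = g' ≫ φ i) → g = g') :
    IsFCG k M := by
  obtain ⟨n, ⟨e⟩⟩ := Finite.exists_equiv_fin ι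
  refine ⟨n, fun i => a (e.symm i), biproduct.lift fun i => φ (e.symm i), ⟨fun g g' hg => ?_⟩⟩
  refine h g g' fun i => ?_
  have := congrArg (fun f => f ≫ biproduct.π (fun i => InjAt k (a (e.symm i))) (e i)) hg
  simp only [Category.assoc, biproduct.lift_π] at this
  rwa [e.symm_apply_apply] at this

theorem IsFG.of_iso {M N : A ⥤ ModuleCat.{0} k} (e : M ≅ N) (h : IsFG k M) : IsFG k N := by
  obtain ⟨r, a, f, hf⟩ := h
  exact ⟨r, a, f ≫ e.hom, epi_comp _ _⟩

theorem IsFCG.of_iso {M N : A ⥤ ModuleCat.{0} k} (e : M ≅ N) (h : IsFCG k M) : IsFCG k N := by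
  obtain ⟨r, a, f, hf⟩ := h
  exact ⟨r, a, e.inv ≫ f, mono_comp _ _⟩

theorem isFP_of_epi {S : A ⥤ ModuleCat.{0} k} {a : A} (p : ProjAt k a ⟶ S) [Epi p]
    (h : IsFG k (kernel p)) : IsFP k S := by
  let e := biproductUniqueIso (fun _ : Fin 1 => ProjAt k a)
  exact ⟨1, fun _ => a, e.hom ≫ p, epi_comp _ _, h.of_iso (kernelIsIsoComp e.hom p).symm⟩

theorem isFCP_of_mono {S : A ⥤ ModuleCat.{0} k} {a : A} (p : S ⟶ InjAt k a) [Mono p]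
    (h : IsFCG k (cokernel p)) : IsFCP k S := by
  let e := biproductUniqueIso (fun _ : Fin 1 => InjAt k a)
  exact ⟨1, fun _ => a, p ≫ e.inv, mono_comp _ _, h.of_iso (cokernelCompIsIso p e.inv).symm⟩

/-- If `S` is finitely presented and `π : E ⟶ S` is an epimorphism which does not split, then
the kernel of `π` receives a nonzero morphism from one of finitely many projectives. -/
theorem IsFP.exists_finite {S : A ⥤ ModuleCat.{0} k} (h : IsFP k S) :
    ∃ T : Set A, T.Finite ∧ ∀ {E : A ⥤ ModuleCat.{0} k} (_ : IsMod k E) (π : E ⟶ S)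
      (_ : ∀ b, Function.Surjective (π.app b).hom) (_ : ∀ t : S ⟶ E, t ≫ π ≠ 𝟙 S),
      ∃ b ∈ T, ∃ e : E.obj b, e ≠ 0 ∧ (π.app b).hom e = 0 := by
  obtain ⟨r, a, f, hf, s, b, g, hg⟩ := h
  refine ⟨Set.range b, Set.finite_range b, fun {E} hE π hπ hns => ?_⟩
  choose x hx using fun i =>
    hπ (a i) (((biproduct.ι (fun i => ProjAt k (a i)) i ≫ f).app (a i)).hom (𝟙 (a i) : a i ⟶ a i))
  let u : (⨁ fun i => ProjAt k (a i)) ⟶ E := biproduct.desc fun i => projHom hE (x i)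
  have hu : u ≫ π = f := by
    refine biproduct.hom_ext' _ _ fun i => projHom_ext ?_
    rw [← hx i, biproduct.ι_desc_assoc]
    change (π.app (a i)).hom ((E.map (𝟙 (a i))).hom (x i)) = _
    rw [E.map_id]; rfl
  by_contra! hcon
  have hz : g ≫ kernel.ι f ≫ u = 0 := by
    refine biproduct.hom_ext' _ _ fun i => projHom_ext ?_
    rw [comp_zero]
    refine of_not_not fun hne => hcon (b i) ⟨i, rfl⟩ _ hne ?_
    have : (biproduct.ι (fun i => ProjAt k (b i)) i ≫ g ≫ kernel.ι f ≫ u) ≫ π = 0 := by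
      simp [hu]
    exact congrArg (fun h => (h.app (b i)).hom (𝟙 (b i) : b i ⟶ b i)) this
  have hz' : kernel.ι f ≫ u = 0 := by rwa [← cancel_epi g, comp_zero]
  refine hns ((Abelian.epiIsCokernelOfKernel _ (kernelIsKernel f)).desc
    (CokernelCofork.ofπ u hz')) ?_
  have h1 := (Abelian.epiIsCokernelOfKernel _ (kernelIsKernel f)).fac (CokernelCofork.ofπ u hz')
    WalkingParallelPair.one
  rw [← cancel_epi f, Category.comp_id, ← Category.assoc]
  exact (congrArg (· ≫ π) h1).trans hu

/-- If `S` is finitely co-presented and `i : S ⟶ E` is a monomorphism which does not split, then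
the cokernel of `i` has a nonzero morphism to one of finitely many injectives. -/
theorem IsFCP.exists_finite {S : A ⥤ ModuleCat.{0} k} (h : IsFCP k S) :
    ∃ T : Set A, T.Finite ∧ ∀ {E : A ⥤ ModuleCat.{0} k} (_ : IsMod k E) (i : S ⟶ E)
      (_ : ∀ b, Function.Injective (i.app b).hom) (_ : ∀ t : E ⟶ S, i ≫ t ≠ 𝟙 S),
      ∃ b ∈ T, ∃ e : E.obj b, e ∉ LinearMap.range (i.app b).hom := by
  obtain ⟨r, a, f, hf, s, b, g, hg⟩ := h
  refine ⟨Set.range b, Set.finite_range b, fun {E} hE i hi hns => ?_⟩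
  choose l hl using fun b => LinearMap.exists_leftInverse_of_injective (i.app b).hom
    (LinearMap.ker_eq_bot.2 (hi b))
  let u : E ⟶ (⨁ fun j => InjAt k (a j)) := biproduct.lift fun j => injHom hE
    (injEval (𝟙 (a j)) ∘ₗ ((f ≫ biproduct.π (fun j => InjAt k (a j)) j).app (a j)).hom ∘ₗ l (a j))
  have hu : i ≫ u = f := by
    refine biproduct.hom_ext _ _ fun j => injHom_ext fun m => ?_
    rw [Category.assoc, biproduct.lift_π]
    change injEval _ (((injHom hE _).app (a j)).hom ((i.app (a j)).hom m)) = _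
    rw [injEval_injHom, E.map_id]
    exact congrArg (fun m => injEval (𝟙 (a j))
      (((f ≫ biproduct.π (fun j => InjAt k (a j)) j).app (a j)).hom m))
      (LinearMap.congr_fun (hl (a j)) m)
  by_contra! hcon
  have hz : (u ≫ cokernel.π f) ≫ g = 0 := by
    refine biproduct.hom_ext _ _ fun j => injHom_ext fun e => ?_
    obtain ⟨m, rfl⟩ := hcon (b j) ⟨j, rfl⟩ e
    have : i ≫ ((u ≫ cokernel.π f) ≫ g) ≫ biproduct.π (fun j => InjAt k (b j)) j = 0 := by
      simp [reassoc_of% hu]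
    rw [zero_comp]
    exact congrArg (fun h => injEval (𝟙 (b j)) ((h.app (b j)).hom m)) this
  have hz' : u ≫ cokernel.π f = 0 := by rwa [← cancel_mono g, zero_comp]
  refine hns
    ((Abelian.monoIsKernelOfCokernel _ (cokernelIsCokernel f)).lift (KernelFork.ofι u hz')) ?_
  have h1 := (Abelian.monoIsKernelOfCokernel _ (cokernelIsCokernel f)).fac
    (KernelFork.ofι u hz') WalkingParallelPair.zero
  rw [← cancel_mono f, Category.id_comp, Category.assoc]
  exact (congrArg (i ≫ ·) h1).trans hu

end Finiteness

section PathCategory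

variable {k} {Q : Type} [Quiver.{0} Q]

/-- A path of `Q`, seen as a morphism of the path category `kQ`. -/
noncomputable def pathHom {x y : Q} (p : Quiver.Path x y) : vtx k Q x ⟶ vtx k Q y :=
  (Free.embedding k (Paths Q)).map (X := (Paths.of Q).obj x) (Y := (Paths.of Q).obj y) p

theorem pathHom_comp {x y z : Q} (p : Quiver.Path x y) (q : Quiver.Path y z) :
    pathHom (k := k) (p.comp q) = pathHom p ≫ pathHom q :=
  (Free.embedding k (Paths Q)).map_comp (X := (Paths.of Q).obj x) (Y := (Paths.of Q).obj y)
    (Z := (Paths.of Q).obj z) p q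

theorem pathHom_cons {x y z : Q} (p : Quiver.Path x y) (α : y ⟶ z) :
    pathHom (k := k) (p.cons α) = pathHom p ≫ arrHom k Q α :=
  pathHom_comp p α.toPath

theorem pathHom_nil (x : Q) : pathHom (k := k) (Quiver.Path.nil : Quiver.Path x x) = 𝟙 _ :=
  (Free.embedding k (Paths Q)).map_id ((Paths.of Q).obj x)

theorem pathCat_hom_induction {x y : Q} {P : (vtx k Q x ⟶ vtx k Q y) → Prop}
    (zero : P 0) (add : ∀ f g, P f → P g → P (f + g)) (smul : ∀ (r : k) f, P f → P (r • f))
    (path : ∀ p : Quiver.Path x y, P (pathHom p)) (f : vtx k Q x ⟶ vtx k Q y) : P f := by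
  refine Finsupp.induction_linear (motive := P) f zero add fun p r => ?_
  have h := Finsupp.smul_single_one (α := Quiver.Path x y) p r
  exact h ▸ smul r _ (path p)

/-- A family of linear maps commuting with the action of the arrows is a morphism of modules. -/
noncomputable def homOfArrows {M N : PathCat k Q ⥤ ModuleCat.{0} k} (hM : IsMod k M)
    (hN : IsMod k N) (φ : ∀ x : Q, M.obj (vtx k Q x) →ₗ[k] N.obj (vtx k Q x))
    (h : ∀ {x y : Q} (α : x ⟶ y) (m : M.obj (vtx k Q x)),
      φ y ((M.map (arrHom k Q α)).hom m) = (N.map (arrHom k Q α)).hom (φ x m)) : M ⟶ N where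
  app x := ModuleCat.ofHom (φ x)
  naturality := fun (x y : Q) f => by
    refine pathCat_hom_induction (x := x) (y := y) (P := fun f =>
      M.map f ≫ ModuleCat.ofHom (φ y) = ModuleCat.ofHom (φ x) ≫ N.map f) ?_ ?_ ?_ ?_ f
    · rw [hM.map_zero, hN.map_zero, zero_comp, comp_zero]
    · intro f g hf hg
      rw [hM.1, hN.1, Preadditive.add_comp, Preadditive.comp_add, hf, hg]
    · intro r f hf
      rw [hM.2, hN.2, Linear.smul_comp, Linear.comp_smul, hf]
    · intro p
      induction p with
      | nil => rw [pathHom_nil, M.map_id, N.map_id]; rfl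
      | cons p α ih =>
        rw [pathHom_cons, M.map_comp, N.map_comp, ← Category.assoc, ← ih (pathHom p),
          Category.assoc,
          Category.assoc]
        congr 1
        ext m
        exact h α m

section OfRep

variable (V : Q → Type) [∀ x, AddCommGroup (V x)] [∀ x, Module k (V x)]
    (φ : ∀ {x y : Q}, (x ⟶ y) → V x →ₗ[k] V y)

/-- The action of a path on a representation of `Q`. -/
def repPath {x : Q} : ∀ {y : Q}, Quiver.Path x y → (V x →ₗ[k] V y)
  | _, .nil => LinearMap.id
  | _, .cons p α => φ α ∘ₗ repPath p

/-- The action of the morphisms of the path category on a representation of `Q`. -/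
noncomputable def repMap (x y : Q) :
    (vtx k Q x ⟶ vtx k Q y) →ₗ[k] (ModuleCat.of k (V x) ⟶ ModuleCat.of k (V y)) :=
  Finsupp.linearCombination k (α := Quiver.Path x y) fun p => ModuleCat.ofHom (repPath V φ p)

theorem repMap_pathHom {x y : Q} (p : Quiver.Path x y) :
    repMap V φ x y (pathHom p) = ModuleCat.ofHom (repPath V φ p) :=
  (Finsupp.linearCombination_single k (α := Quiver.Path x y) _ _).trans (one_smul _ _)

theorem repMap_pathHom_nil (x : Q) :
    repMap V φ x x (pathHom Quiver.Path.nil) = 𝟙 (ModuleCat.of k (V x)) :=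
  repMap_pathHom V φ Quiver.Path.nil

theorem repMap_pathHom_cons {x y z : Q} (p : Quiver.Path x y) (α : y ⟶ z) :
    repMap V φ x z (pathHom (p.cons α)) =
      repMap V φ x y (pathHom p) ≫ ModuleCat.ofHom (φ α) := by
  rw [repMap_pathHom, repMap_pathHom]
  rfl

theorem repMap_comp {x y z : Q} (f : vtx k Q x ⟶ vtx k Q y) (g : vtx k Q y ⟶ vtx k Q z) :
    repMap V φ x z (f ≫ g) = repMap V φ x y f ≫ repMap V φ y z g := by
  refine pathCat_hom_induction (P := fun f =>
    repMap V φ x z (f ≫ g) = repMap V φ x y f ≫ repMap V φ y z g) ?_ ?_ ?_ (fun p => ?_) f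
  · simp
  · intro f f' hf hf'
    rw [Preadditive.add_comp, map_add, map_add, Preadditive.add_comp, hf, hf']
  · intro r f hf
    rw [Linear.smul_comp, map_smul, map_smul, Linear.smul_comp, hf]
  refine pathCat_hom_induction (P := fun g =>
    repMap V φ x z (pathHom p ≫ g) = repMap V φ x y (pathHom p) ≫ repMap V φ y z g)
    ?_ ?_ ?_ (fun q => ?_) g
  · simp
  · intro f f' hf hf'
    rw [Preadditive.comp_add, map_add, map_add, Preadditive.comp_add, hf, hf']
  · intro r f hf
    rw [Linear.comp_smul, map_smul, map_smul, Linear.comp_smul, hf]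
  · rw [← pathHom_comp]
    induction q with
    | nil => rw [repMap_pathHom_nil, Category.comp_id]; rfl
    | cons q α ih =>
      rw [Quiver.Path.comp_cons, repMap_pathHom_cons, repMap_pathHom_cons, ih (pathHom q),
        Category.assoc]

/-- The module over `kQ` given by a representation of `Q`. -/
noncomputable def ofRep : PathCat k Q ⥤ ModuleCat.{0} k where
  obj := fun x : Q => ModuleCat.of k (V x)
  map := fun {x y : Q} f => repMap V φ x y f
  map_id := fun x : Q =>
    (congrArg (repMap V φ x x) (pathHom_nil x)).symm.trans (repMap_pathHom_nil V φ x)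
  map_comp := fun {x y z : Q} f g => repMap_comp V φ (x := x) (y := y) (z := z) f g

theorem isMod_ofRep : IsMod k (ofRep V φ) :=
  ⟨fun {x y : Q} => map_add (repMap V φ x y), fun {x y : Q} => map_smul (repMap V φ x y)⟩

theorem ofRep_map_arrHom {x y : Q} (α : x ⟶ y) :
    (ofRep V φ).map (arrHom k Q α) = ModuleCat.ofHom (φ α) := by
  refine (repMap_pathHom_cons V φ Quiver.Path.nil α).trans ?_
  rw [repMap_pathHom_nil, Category.id_comp]

end OfRep

theorem IntervalFinite.finite_hom (hQ : IntervalFinite Q) (x y : Q) : Finite (x ⟶ y) := by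
  have := hQ x y
  refine Finite.of_injective (fun α : x ⟶ y => α.toPath) fun α β h => ?_
  simpa [Quiver.Hom.toPath] using h

theorem IntervalFinite.isEmpty_path (hQ : IntervalFinite Q) {x y : Q} (α : x ⟶ y) :
    IsEmpty (Quiver.Path y x) := by
  refine ⟨fun p => ?_⟩
  have := hQ y y
  let l : Quiver.Path y y := p.cons α
  let pow : ℕ → Quiver.Path y y := fun n => n.rec .nil fun _ q => q.comp l
  have hpow : ∀ n, (pow n).length = n * (p.length + 1) := by
    intro n
    induction n with
    | zero => simp [pow]
    | succ n ih =>
      change ((pow n).comp l).length = _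
      rw [Quiver.Path.length_comp, ih]
      simp only [l, Quiver.Path.length_cons]
      ring
  refine not_injective_infinite_finite pow fun m n h => ?_
  have := congrArg Quiver.Path.length h
  rw [hpow, hpow] at this
  exact Nat.eq_of_mul_eq_mul_right (Nat.succ_pos _) this

theorem IntervalFinite.hom_eq_zero (hQ : IntervalFinite Q) {x y : Q} (α : x ⟶ y)
    (f : vtx k Q y ⟶ vtx k Q x) : f = 0 := by
  have := hQ.isEmpty_path α
  exact Subsingleton.elim (α := Quiver.Path y x →₀ k) f 0

open Classical in
/-- The identity morphism if `x = y`, and zero otherwise. -/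
noncomputable def diagHom (x y : Q) : vtx k Q x ⟶ vtx k Q y :=
  if h : x = y then eqToHom (congrArg _ h) else 0

theorem diagHom_self (x : Q) : diagHom x x = 𝟙 (vtx k Q x) := by simp [diagHom]

theorem exists_eq_add_smul_diagHom {x y : Q}
    (R : Submodule k (vtx k Q x ⟶ vtx k Q y))
    (hR : ∀ p : Quiver.Path x y, p.length ≠ 0 → pathHom p ∈ R) (f : vtx k Q x ⟶ vtx k Q y) :
    ∃ r ∈ R, ∃ c : k, f = r + c • diagHom x y := by
  refine pathCat_hom_induction (P := fun f => ∃ r ∈ R, ∃ c : k, f = r + c • diagHom x y)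
    ?_ ?_ ?_ ?_ f
  · exact ⟨0, R.zero_mem, 0, by simp⟩
  · rintro _ _ ⟨r, hr, c, rfl⟩ ⟨r', hr', c', rfl⟩
    exact ⟨r + r', R.add_mem hr hr', c + c', by rw [add_smul]; abel⟩
  · rintro s _ ⟨r, hr, c, rfl⟩
    exact ⟨s • r, R.smul_mem s hr, s * c, by rw [smul_add, smul_smul]⟩
  · intro p
    by_cases hp : p.length = 0
    · obtain rfl := Quiver.Path.eq_of_length_zero p hp
      obtain rfl := Quiver.Path.eq_nil_of_length_zero p hp
      exact ⟨0, R.zero_mem, 1, by rw [pathHom_nil, diagHom_self]; simp⟩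
    · exact ⟨_, hR p hp, 0, by simp⟩

theorem exists_eq_add_smul_diagHom_of_source {x y : Q}
    (R : Submodule k (vtx k Q x ⟶ vtx k Q y))
    (hR : ∀ {z : Q} (α : x ⟶ z) (g : vtx k Q z ⟶ vtx k Q y), arrHom k Q α ≫ g ∈ R)
    (f : vtx k Q x ⟶ vtx k Q y) : ∃ r ∈ R, ∃ c : k, f = r + c • diagHom x y := by
  refine exists_eq_add_smul_diagHom R (fun p hp => ?_) f
  obtain ⟨n, hn⟩ := Nat.exists_eq_succ_of_ne_zero hp
  obtain ⟨z, α, q, -, rfl⟩ := p.eq_toPath_comp_of_length_eq_succ hn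
  rw [pathHom_comp]
  exact hR α _

theorem exists_eq_add_smul_diagHom_of_target {x y : Q}
    (R : Submodule k (vtx k Q x ⟶ vtx k Q y))
    (hR : ∀ {z : Q} (α : z ⟶ y) (g : vtx k Q x ⟶ vtx k Q z), g ≫ arrHom k Q α ∈ R)
    (f : vtx k Q x ⟶ vtx k Q y) : ∃ r ∈ R, ∃ c : k, f = r + c • diagHom x y := by
  refine exists_eq_add_smul_diagHom R (fun p hp => ?_) f
  cases p with
  | nil => exact absurd rfl hp
  | cons q α => rw [pathHom_cons]; exact hR α _

end PathCategory

section LocallyFiniteOfSimple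

variable {Q : Type}

open Classical in
/-- The action of an arrow from `b` to `c` on `extAt k x y`. -/
noncomputable def extAct (x y b c : Q) : ((PLift (b = x) → k) × (PLift (b = y) → k)) →ₗ[k]
    ((PLift (c = x) → k) × (PLift (c = y) → k)) :=
  LinearMap.inr k _ _ ∘ₗ
    (LinearMap.pi fun _ => if hb : b = x then LinearMap.proj ⟨hb⟩ else 0) ∘ₗ LinearMap.fst k _ _

theorem extAct_apply (x y b c : Q) (m : (PLift (b = x) → k) × (PLift (b = y) → k)) :
    extAct k x y b c m =
      (0, fun _ => open Classical in if hb : b = x then m.1 ⟨hb⟩ else 0) := by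
  refine Prod.ext rfl (funext fun _ => ?_)
  by_cases hb : b = x <;> simp [extAct, hb]

variable [Quiver.{0} Q]

/-- The simple module at the vertex `x`. -/
noncomputable def simpleAt (x : Q) : PathCat k Q ⥤ ModuleCat.{0} k :=
  ofRep (fun b => PLift (b = x) → k) fun _ => 0

/-- The extension of the simple module at `x` by the simple module at `y` on which every arrow
from `x` to `y` acts as the identity of `k`. -/
noncomputable def extAt (x y : Q) : PathCat k Q ⥤ ModuleCat.{0} k :=
  ofRep (fun b => (PLift (b = x) → k) × (PLift (b = y) → k)) fun _ => extAct k x y _ _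

theorem isMod_simpleAt (x : Q) : IsMod k (simpleAt k x) := isMod_ofRep _ _

theorem isMod_extAt (x y : Q) : IsMod k (extAt k x y) := isMod_ofRep _ _

theorem simpleAt_map_arrHom (x : Q) {b c : Q} (α : b ⟶ c) :
    (simpleAt k x).map (arrHom k Q α) = 0 :=
  ofRep_map_arrHom _ _ α

theorem extAt_map_arrHom (x y : Q) {b c : Q} (α : b ⟶ c)
    (m : (PLift (b = x) → k) × (PLift (b = y) → k)) :
    ((extAt k x y).map (arrHom k Q α)).hom m =
      ((0, fun _ => open Classical in if hb : b = x then m.1 ⟨hb⟩ else 0) :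
        (PLift (c = x) → k) × (PLift (c = y) → k)) := by
  rw [← extAct_apply]
  exact congrArg (fun g => g.hom m)
    (ofRep_map_arrHom _ (fun {b c} (_ : b ⟶ c) => extAct k x y b c) α)

/-- The projection of the extension onto the simple module at `x`. -/
noncomputable def extAtFst (x y : Q) : extAt k x y ⟶ simpleAt k x :=
  homOfArrows (isMod_extAt k x y) (isMod_simpleAt k x)
    (fun b => LinearMap.fst k (PLift (b = x) → k) (PLift (b = y) → k))
    (fun α m => by
      rw [simpleAt_map_arrHom]
      exact congrArg Prod.fst (extAt_map_arrHom k x y α m))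

/-- The inclusion of the simple module at `y` into the extension. -/
noncomputable def extAtInr (x y : Q) : simpleAt k y ⟶ extAt k x y :=
  homOfArrows (isMod_simpleAt k y) (isMod_extAt k x y)
    (fun b => LinearMap.inr k (PLift (b = x) → k) (PLift (b = y) → k))
    (fun {b c} α m => by
      rw [simpleAt_map_arrHom]
      refine Eq.trans ?_ (extAt_map_arrHom k x y α (0, m)).symm
      refine Prod.ext rfl (funext fun _ => ?_)
      change (0 : k) = _
      by_cases hb : b = x <;> simp [hb])

theorem comp_extAtFst_ne_id {x y : Q} (α : x ⟶ y) (t : simpleAt k x ⟶ extAt k x y) :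
    t ≫ extAtFst k x y ≠ 𝟙 _ := by
  intro h
  let v : PLift (x = x) → k := fun _ => 1
  let w : (PLift (x = x) → k) × (PLift (x = y) → k) := (t.app x).hom v
  have h1 : w.1 = v := congrArg (fun g => (g.app x).hom v) h
  have h2 := congrArg (fun g => g.hom v) (t.naturality (arrHom k Q α))
  rw [simpleAt_map_arrHom] at h2
  have h3 : (0 : (PLift (y = x) → k) × (PLift (y = y) → k)) =
      ((extAt k x y).map (arrHom k Q α)).hom w :=
    (map_zero (t.app y).hom).symm.trans h2
  rw [extAt_map_arrHom] at h3
  have h4 := congrFun (congrArg Prod.snd h3) ⟨rfl⟩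
  simp [h1, v] at h4

theorem extAtInr_comp_ne_id {x y : Q} (α : x ⟶ y) (t : extAt k x y ⟶ simpleAt k y) :
    extAtInr k x y ≫ t ≠ 𝟙 _ := by
  intro h
  let v : PLift (y = y) → k := fun _ => 1
  let w : (PLift (x = x) → k) × (PLift (x = y) → k) := (fun _ => 1, 0)
  have h1 : (t.app y).hom (0, v) = v := congrArg (fun g => (g.app y).hom v) h
  have h2 := congrArg (fun g => g.hom w) (t.naturality (arrHom k Q α))
  rw [simpleAt_map_arrHom] at h2
  have h3 : (t.app y).hom (((extAt k x y).map (arrHom k Q α)).hom w) =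
    (0 : PLift (y = y) → k) := h2
  rw [extAt_map_arrHom] at h3
  have h4 : v = 0 := by
    rw [← h1, ← h3]
    congr 2
    simp [w, v]
  exact one_ne_zero (congrFun h4 ⟨rfl⟩)

theorem simple_simpleAt (x : Q) : Simple (simpleAt k x) := by
  refine ⟨fun {Y} f hf => ⟨fun hi h0 => ?_, fun h => ?_⟩⟩
  · subst h0
    have h1 : 𝟙 (simpleAt k x) = 0 := by
      rw [← IsIso.inv_hom_id (0 : Y ⟶ simpleAt k x), comp_zero]
    have h2 : (fun _ => 1 : PLift (x = x) → k) = 0 :=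
      congrArg (fun g => (g.app x).hom (fun _ => 1 : PLift (x = x) → k)) h1
    exact one_ne_zero (congrFun h2 ⟨rfl⟩)
  · obtain ⟨b, m, hm⟩ : ∃ (b : Q) (m : Y.obj b),
        (show PLift (b = x) → k from (f.app b).hom m) ≠ 0 := by
      by_contra! hcon
      refine h ?_
      ext b m
      exact hcon b m
    obtain ⟨⟨rfl⟩, hb⟩ := Function.ne_iff.1 hm
    rw [NatTrans.isIso_iff_isIso_app]
    intro c
    rw [ConcreteCategory.isIso_iff_bijective]
    refine ⟨(ModuleCat.mono_iff_injective _).1 ((NatTrans.mono_iff_mono_app f).1 hf c), ?_⟩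
    intro (w : PLift ((show Q from c) = b) → k)
    by_cases hc : (show Q from c) = b
    · obtain rfl : c = b := hc
      refine ⟨(w ⟨rfl⟩ / (show PLift ((show Q from c) = c) → k from (f.app c).hom m) ⟨rfl⟩) • m, ?_⟩
      refine (map_smul (f.app c).hom _ _).trans (funext fun _ => ?_)
      exact div_mul_cancel₀ _ hb
    · exact ⟨0, (map_zero (f.app c).hom).trans (funext fun h => absurd h.down hc)⟩



variable {k}

theorem finite_sigma_of_isFP (hQ : IntervalFinite Q) (x : Q)
    (h : IsFP k (simpleAt k x)) : Finite (Σ y : Q, x ⟶ y) := by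
  obtain ⟨T, hT, h⟩ := h.exists_finite
  have hmem : ∀ {y : Q}, (x ⟶ y) → y ∈ T := by
    intro y α
    obtain ⟨b, hb, e, he, he'⟩ := h (isMod_extAt k x y) (extAtFst k x y)
      (fun b w => ⟨(w, 0), rfl⟩) (comp_extAtFst_ne_id k α)
    let e' : (PLift ((show Q from b) = x) → k) × (PLift ((show Q from b) = y) → k) := e
    have h1 : e'.2 ≠ 0 := fun h0 => he (Prod.ext he' h0)
    obtain ⟨⟨rfl⟩, -⟩ := Function.ne_iff.1 h1
    exact hb
  have := hT.to_subtype
  have := hQ.finite_hom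
  exact Finite.of_injective
    (fun p => ⟨⟨p.1, hmem p.2⟩, p.2⟩ : (Σ y : Q, x ⟶ y) → Σ y : T, x ⟶ (show Q from y.1))
    fun ⟨y, α⟩ ⟨z, β⟩ h => by cases h; rfl

theorem finite_sigma_of_isFCP (hQ : IntervalFinite Q) (y : Q)
    (h : IsFCP k (simpleAt k y)) : Finite (Σ x : Q, x ⟶ y) := by
  obtain ⟨T, hT, h⟩ := h.exists_finite
  have hmem : ∀ {x : Q}, (x ⟶ y) → x ∈ T := by
    intro x α
    obtain ⟨b, hb, e, he⟩ := h (isMod_extAt k x y) (extAtInr k x y)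
      (fun b w w' hw => congrArg Prod.snd hw) (extAtInr_comp_ne_id k α)
    let e' : (PLift ((show Q from b) = x) → k) × (PLift ((show Q from b) = y) → k) := e
    have h1 : e'.1 ≠ 0 := fun h0 => he ⟨e'.2, Prod.ext h0.symm rfl⟩
    obtain ⟨⟨rfl⟩, -⟩ := Function.ne_iff.1 h1
    exact hb
  have := hT.to_subtype
  have := hQ.finite_hom
  exact Finite.of_injective
    (fun p => ⟨⟨p.1, hmem p.2⟩, p.2⟩ : (Σ x : Q, x ⟶ y) → Σ x : T, (show Q from x.1) ⟶ y)
    fun ⟨y, α⟩ ⟨z, β⟩ h => by cases h; rfl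

end LocallyFiniteOfSimple

section SimpleOfLocallyFinite

variable {k} {A : Type} [Category.{0} A] [Preadditive A] [CategoryTheory.Linear k A]

theorem projHom_surjective {S : A ⥤ ModuleCat.{0} k} [Simple S] (hS : IsMod k S) {a : A}
    {v : S.obj a} (hv : v ≠ 0) :
    Epi (projHom hS v) ∧ ∀ {b : A} (m : S.obj b), ∃ f : a ⟶ b, (S.map f).hom v = m := by
  have hne : projHom hS v ≠ 0 := by
    intro h
    have h1 : ((projHom hS v).app a).hom (𝟙 a : a ⟶ a) = 0 := by rw [h]; rfl
    rw [projHom_app, S.map_id] at h1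
    exact hv h1
  have hepi := epi_of_nonzero_to_simple hne
  refine ⟨hepi, fun {b} m => ?_⟩
  exact (ModuleCat.epi_iff_surjective _).1 ((NatTrans.epi_iff_epi_app _).1 hepi b) m

variable {Q : Type} [Quiver.{0} Q] {S : PathCat k Q ⥤ ModuleCat.{0} k} [Simple S]

variable (S) in
theorem exists_ne_zero_of_simple : ∃ (x : Q) (v : S.obj (vtx k Q x)), v ≠ 0 := by
  by_contra! hcon
  refine id_nonzero S ?_
  ext x m
  exact hcon x m

theorem map_arrHom_eq_zero_of_source (hQ : IntervalFinite Q) (hS : IsMod k S) {x y : Q}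
    (α : x ⟶ y) (v : S.obj (vtx k Q x)) : (S.map (arrHom k Q α)).hom v = 0 := by
  by_contra hw
  obtain ⟨g, hg⟩ := (projHom_surjective hS hw).2 v
  rw [hQ.hom_eq_zero α g, hS.map_zero] at hg
  refine hw ?_
  rw [← hg]
  exact map_zero _

theorem isFP_of_simple (hQ : IntervalFinite Q) (hfin : ∀ x : Q, Finite (Σ y : Q, x ⟶ y))
    (hS : IsMod k S) : IsFP k S := by
  obtain ⟨x, v, hv⟩ := exists_ne_zero_of_simple S
  have := (projHom_surjective hS hv).1
  refine isFP_of_epi (projHom hS v) ?_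
  have := hfin x
  have hα : ∀ {y : Q} (α : x ⟶ y),
      projHom (isMod_projAt (vtx k Q x)) (arrHom k Q α) ≫ projHom hS v = 0 := fun {y} α => by
    refine projHom_ext ?_
    refine Eq.trans ?_ (map_arrHom_eq_zero_of_source hQ hS α v)
    exact congrArg (fun f => (S.map f).hom v) (Category.comp_id (arrHom k Q α))
  refine isFG_of_finite (ι := Σ y : Q, x ⟶ y) (fun p => vtx k Q p.1)
    (fun p => kernel.lift (projHom hS v) _ (hα p.2)) fun {N} g g' h => ?_
  ext b m
  let W : Submodule k ((kernel (projHom hS v)).obj b) :=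
    LinearMap.eqLocus (g.app b).hom (g'.app b).hom
  let ι := ((kernel.ι (projHom hS v)).app b).hom
  have hι : Function.Injective ι := (ModuleCat.mono_iff_injective _).1
    ((NatTrans.mono_iff_mono_app (kernel.ι (projHom hS v))).1 inferInstance b)
  have hp : ∀ n, ((projHom hS v).app b).hom (ι n) = 0 := fun n =>
    congrArg (fun f => (f.app b).hom n) (kernel.condition (projHom hS v))
  obtain ⟨r, ⟨w, hw, hwr⟩, c, hc⟩ := exists_eq_add_smul_diagHom_of_source (x := x) (y := b)
    (W.map ι) (fun {z} α u => by
      refine ⟨((kernel.lift (projHom hS v) _ (hα α)).app b).hom u, ?_, ?_⟩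
      · exact congrArg (fun f => (f.app b).hom u) (h ⟨z, α⟩)
      · exact congrArg (fun f => (f.app b).hom u) (kernel.lift_ι (projHom hS v) _ (hα α))) (ι m)
  have hD : c • diagHom (k := k) x b = 0 := by
    have h1 : c • (S.map (diagHom (k := k) x b)).hom v = 0 := by
      have h2 := hp m
      rw [hc, ← hwr] at h2
      refine Eq.trans ?_ ((map_add ((projHom hS v).app b).hom (ι w)
        (c • diagHom (k := k) x b)).symm.trans h2)
      rw [hp, zero_add]
      exact (map_smul ((projHom hS v).app b).hom c (diagHom (k := k) x b)).symm
    by_cases hb : x = b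
    · subst hb
      rw [diagHom_self, S.map_id] at h1
      rw [(smul_eq_zero.1 h1).resolve_right hv, zero_smul]
    · simp [diagHom, hb]
  rw [hD, add_zero, ← hwr] at hc
  rw [hι hc]
  exact hw

theorem exists_injHom_app_eq (hQ : IntervalFinite Q) (hS : IsMod k S) {x b : Q}
    {v : S.obj (vtx k Q x)} {φ : S.obj (vtx k Q x) →ₗ[k] k} (hφ : φ v ≠ 0)
    (ξ : (InjAt k (vtx k Q x)).obj (vtx k Q b))
    (hξ : ∀ {y : Q} (α : y ⟶ x) (u : vtx k Q b ⟶ vtx k Q y),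
      injEval (u ≫ arrHom k Q α) ξ = 0) :
    ∃ s : S.obj (vtx k Q b), ((injHom hS φ).app (vtx k Q b)).hom s = ξ := by
  let l : (vtx k Q b ⟶ vtx k Q x) →ₗ[k] k := ξ
  by_cases hb : x = b
  · subst hb
    refine ⟨(l (𝟙 _) / φ v) • v, inj_ext fun f => ?_⟩
    let l' : (vtx k Q x ⟶ vtx k Q x) →ₗ[k] k := ((injHom hS φ).app (vtx k Q x)).hom v
    have hl' : ∀ u, l' u = φ ((S.map u).hom v) := fun u => rfl
    obtain ⟨r, ⟨hr, hr'⟩, c, rfl⟩ := exists_eq_add_smul_diagHom_of_target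
      (LinearMap.ker l ⊓ LinearMap.ker l') (fun {z} α u => by
        refine ⟨hξ α u, ?_⟩
        change φ ((S.map (u ≫ arrHom k Q α)).hom v) = 0
        rw [S.map_comp]
        exact (congrArg φ (map_arrHom_eq_zero_of_source hQ hS α _)).trans (map_zero φ)) f
    have hr : l r = 0 := hr
    have hr' : l' r = 0 := hr'
    refine (congrArg (injEval (r + c • diagHom x x))
      (map_smul ((injHom hS φ).app (vtx k Q x)).hom (l (𝟙 _) / φ v) v)).trans ?_
    change (l (𝟙 _) / φ v) * l' (r + c • diagHom x x) = l (r + c • diagHom x x)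
    have h1 : l' (𝟙 _) = φ v := by rw [hl', S.map_id]; rfl
    rw [map_add, map_add, hr, hr', map_smul, map_smul, diagHom_self, h1]
    simp only [smul_eq_mul, zero_add]
    field_simp
  · refine ⟨0, (map_zero _).trans (inj_ext fun f => ?_)⟩
    obtain ⟨r, hr, c, rfl⟩ := exists_eq_add_smul_diagHom_of_target
      (LinearMap.ker l) (fun α u => hξ α u) f
    have hr : l r = 0 := hr
    rw [diagHom, dif_neg (Ne.symm hb), smul_zero, add_zero]
    exact (map_zero _).trans hr.symm

theorem isFCP_of_simple (hQ : IntervalFinite Q) (hfin : ∀ y : Q, Finite (Σ x : Q, x ⟶ y))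
    (hS : IsMod k S) : IsFCP k S := by
  obtain ⟨x, v, hv⟩ := exists_ne_zero_of_simple S
  obtain ⟨φ, hφ⟩ : ∃ φ : S.obj (vtx k Q x) →ₗ[k] k, φ v ≠ 0 := by
    by_contra! h
    exact hv ((Module.forall_dual_apply_eq_zero_iff k v).1 h)
  have hev : ∀ {b : Q} (f : vtx k Q b ⟶ vtx k Q x) (m : S.obj (vtx k Q b)),
      injEval f (((injHom hS φ).app _).hom m) = φ ((S.map f).hom m) := fun f m => rfl
  have hmono : Mono (injHom hS φ) := by
    refine mono_of_nonzero_from_simple fun h => hφ ?_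
    have h1 := hev (𝟙 _) v
    rw [h, S.map_id] at h1
    exact h1.symm
  refine isFCP_of_mono (injHom hS φ) ?_
  have := hfin x
  have hα : ∀ {y : Q} (α : y ⟶ x),
      injHom hS φ ≫ injHom (isMod_injAt (vtx k Q x)) (injEval (arrHom k Q α)) = 0 :=
    fun {y} α => by
      refine injHom_ext fun m => ?_
      refine Eq.trans ?_ ((congrArg φ (map_arrHom_eq_zero_of_source hQ hS α m)).trans
        (map_zero φ))
      exact congrArg (fun f => φ ((S.map f).hom m)) (Category.id_comp (arrHom k Q α))
  refine isFCG_of_finite (ι := Σ y : Q, y ⟶ x) (fun p => vtx k Q p.1)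
    (fun p => cokernel.desc (injHom hS φ) _ (hα p.2)) fun {N} g g' h => ?_
  ext b n
  obtain ⟨ξ, hξ⟩ := (ModuleCat.epi_iff_surjective _).1
    ((NatTrans.epi_iff_epi_app (cokernel.π (injHom hS φ))).1 inferInstance b)
    ((g.app b).hom n - (g'.app b).hom n)
  have hξα : ∀ {y : Q} (α : y ⟶ x) (u : b ⟶ vtx k Q y), injEval (u ≫ arrHom k Q α) ξ = 0 := by
    intro y α u
    have h1 : ((cokernel.desc (injHom hS φ) _ (hα α)).app b).hom
        (((cokernel.π (injHom hS φ)).app b).hom ξ) = 0 := by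
      refine (congrArg _ hξ).trans ?_
      rw [map_sub, sub_eq_zero]
      exact congrArg (fun f => (f.app b).hom n) (h ⟨y, α⟩)
    have h2 := congrArg (fun f => injEval u ((f.app b).hom ξ))
      (cokernel.π_desc (injHom hS φ) _ (hα α))
    refine h2.symm.trans ?_
    exact (congrArg (injEval u) h1).trans (map_zero _)
  obtain ⟨s, rfl⟩ := exists_injHom_app_eq (b := b) hQ hS hφ ξ hξα
  rw [← sub_eq_zero]
  refine hξ.symm.trans ?_
  exact congrArg (fun f => (f.app b).hom s) (cokernel.condition (injHom hS φ))

end SimpleOfLocallyFinite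


variable (k : Type) [Field k] [IsAlgClosed k]
variable (Q : Type) [Quiver.{0} Q]

/-- For an interval finite quiver `Q`, every simple module in `Mod kQ` is finitely
presented and finitely co-presented if and only if `Q` is locally finite. -/
theorem statement_2 (hQ : IntervalFinite Q) :
    (∀ S : PathCat k Q ⥤ ModuleCat.{0} k, IsMod k S → Simple S → IsFP k S ∧ IsFCP k S) ↔
      LocallyFinite Q := by
  constructor
  · intro h x
    have hx := h _ (isMod_simpleAt k x) (simple_simpleAt k x)
    exact ⟨finite_sigma_of_isFP hQ x hx.1, finite_sigma_of_isFCP hQ x hx.2⟩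
  · intro h S hS _
    exact ⟨isFP_of_simple hQ (fun x => (h x).1) hS, isFCP_of_simple hQ (fun x => (h x).2) hS⟩

end Paper
end

section
/- Let k be an algebraically closed field and A a spectroid over k. If f : L → M is an irreducible monomorphism in mod A, then the cokernel coker(f) of f (computed in Mod A) is finitely generated. -/
open CategoryTheory CategoryTheory.Limits

namespace Paper

variable (k : Type) [Field k]

section FinitelyGeneratedCokernel

/-- Along a proper filter, the scalar functions with an eventual value admit a linear extension
of the eventual-value functional to all functions. -/
theorem exists_linear_extension_eventual_value {D : Type} (l : Filter D) [l.NeBot] :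
    ∃ lim : (D → k) →ₗ[k] k, ∀ (u : D → k) (c : k), (∀ᶠ x in l, u x = c) → lim u = c := by
  let Z : Submodule k (D → k) :=
    { carrier := {u | ∀ᶠ x in l, u x = 0}
      add_mem' := by
        intro u v hu hv
        filter_upwards [hu, hv] with x hx hy
        simp [hx, hy]
      zero_mem' := Filter.Eventually.of_forall fun _ => rfl
      smul_mem' := by
        intro r u hu
        filter_upwards [hu] with x hx
        simp [hx] }
  have hZ : ∀ u, u ∈ Z ↔ ∀ᶠ x in l, u x = 0 := fun _ => Iff.rfl
  let j : k →ₗ[k] (D → k) ⧸ Z := Z.mkQ ∘ₗ LinearMap.pi fun _ => LinearMap.id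
  have hj : LinearMap.ker j = ⊥ := by
    rw [LinearMap.ker_eq_bot']
    intro c hc
    have hc' : (fun _ : D => c) ∈ Z := (Submodule.Quotient.mk_eq_zero Z).1 hc
    obtain ⟨_, hx⟩ := ((hZ _).1 hc').exists
    exact hx
  obtain ⟨r, hr⟩ := j.exists_leftInverse_of_injective hj
  refine ⟨r ∘ₗ Z.mkQ, fun u c hu => ?_⟩
  have hq : Z.mkQ u = j c := by
    refine (Submodule.Quotient.eq Z).2 ((hZ _).2 ?_)
    filter_upwards [hu] with x hx
    simp [hx]
  change r (Z.mkQ u) = c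
  rw [hq]
  exact LinearMap.congr_fun hr c

variable {k}

/-- The coordinatewise extension of a functional on scalar functions to functions with values in
a finite-dimensional space. -/
noncomputable def vectorLim {D : Type} (lim : (D → k) →ₗ[k] k) (V : Type) [AddCommGroup V]
    [Module k V] [FiniteDimensional k V] (u : D → V) : V :=
  ∑ i, lim (fun x => (Module.finBasis k V).coord i (u x)) • Module.finBasis k V i

theorem dual_vectorLim {D : Type} (lim : (D → k) →ₗ[k] k) {V : Type} [AddCommGroup V]
    [Module k V] [FiniteDimensional k V] (u : D → V) (ξ : Module.Dual k V) :
    ξ (vectorLim lim V u) = lim fun x => ξ (u x) := by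
  have h : (fun x => ξ (u x)) = ∑ i, ξ (Module.finBasis k V i) •
      fun x => (Module.finBasis k V).coord i (u x) := by
    funext x
    conv_lhs => rw [← (Module.finBasis k V).sum_repr (u x)]
    simp only [map_sum, map_smul, smul_eq_mul, Finset.sum_apply, Pi.smul_apply,
      Module.Basis.coord_apply, mul_comm]
  rw [h, vectorLim]
  simp [mul_comm]

theorem eq_of_forall_dual_eq {V : Type} [AddCommGroup V] [Module k V] {v w : V}
    (h : ∀ ξ : Module.Dual k V, ξ v = ξ w) : v = w := by
  rw [← sub_eq_zero, ← Module.forall_dual_apply_eq_zero_iff k]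
  intro ξ
  rw [map_sub, h, sub_self]

theorem lim_congr {D : Type} {l : Filter D} {lim : (D → k) →ₗ[k] k}
    (hlim : ∀ (u : D → k) (c : k), (∀ᶠ x in l, u x = c) → lim u = c) {u v : D → k}
    (h : ∀ᶠ x in l, u x = v x) : lim u = lim v := by
  rw [← sub_eq_zero, ← map_sub]
  refine hlim _ 0 ?_
  filter_upwards [h] with x hx
  simp [hx]

theorem vectorLim_eq_of_eventually_map {D : Type} {l : Filter D} {lim : (D → k) →ₗ[k] k}
    (hlim : ∀ (u : D → k) (c : k), (∀ᶠ x in l, u x = c) → lim u = c)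
    {V W : Type} [AddCommGroup V] [Module k V] [FiniteDimensional k V]
    [AddCommGroup W] [Module k W] [FiniteDimensional k W] (φ : V →ₗ[k] W)
    {u : D → V} {v : D → W} (h : ∀ᶠ x in l, v x = φ (u x)) :
    vectorLim lim W v = φ (vectorLim lim V u) := by
  refine eq_of_forall_dual_eq (k := k) fun ξ => ?_
  have hφ := dual_vectorLim lim u (ξ ∘ₗ φ)
  simp only [LinearMap.comp_apply] at hφ
  rw [dual_vectorLim, hφ]
  refine lim_congr hlim ?_
  filter_upwards [h] with x hx
  rw [hx]

theorem vectorLim_add_of_eventually {D : Type} {l : Filter D} {lim : (D → k) →ₗ[k] k}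
    (hlim : ∀ (u : D → k) (c : k), (∀ᶠ x in l, u x = c) → lim u = c)
    {V : Type} [AddCommGroup V] [Module k V] [FiniteDimensional k V]
    {u v w : D → V} (h : ∀ᶠ x in l, w x = u x + v x) :
    vectorLim lim V w = vectorLim lim V u + vectorLim lim V v := by
  refine eq_of_forall_dual_eq (k := k) fun ξ => ?_
  rw [map_add, dual_vectorLim, dual_vectorLim, dual_vectorLim, ← map_add]
  refine lim_congr hlim ?_
  filter_upwards [h] with x hx
  simp [hx]

theorem vectorLim_eq_of_eventually_const {D : Type} {l : Filter D} {lim : (D → k) →ₗ[k] k}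
    (hlim : ∀ (u : D → k) (c : k), (∀ᶠ x in l, u x = c) → lim u = c)
    {V : Type} [AddCommGroup V] [Module k V] [FiniteDimensional k V]
    {u : D → V} {v : V} (h : ∀ᶠ x in l, u x = v) :
    vectorLim lim V u = v := by
  refine eq_of_forall_dual_eq (k := k) fun ξ => ?_
  rw [dual_vectorLim]
  refine hlim _ _ ?_
  filter_upwards [h] with x hx
  rw [hx]

section Abelian

variable {C : Type*} [Category* C] [Abelian C]

/-- If `L ⟶ X ×_{coker f} M` is a split monomorphism, then `X ⟶ coker f` lifts to `M`. -/
theorem exists_lift_of_isSplitMono_pullback_lift {L M X : C} (f : L ⟶ M) [Mono f]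
    (i : X ⟶ cokernel f)
    (h : IsSplitMono (pullback.lift (f := i) (g := cokernel.π f) 0 f
      (by rw [zero_comp, cokernel.condition]))) :
    ∃ t : X ⟶ M, t ≫ cokernel.π f = i := by
  obtain ⟨⟨r, hr⟩⟩ := h
  have hcomm := pullback.condition (f := i) (g := cokernel.π f)
  set fst := pullback.fst i (cokernel.π f) with hfst
  set snd := pullback.snd i (cokernel.π f) with hsnd
  set u : L ⟶ pullback i (cokernel.π f) :=
    pullback.lift 0 f (by rw [zero_comp, cokernel.condition])
  have hu : u ≫ snd = f := pullback.lift_snd _ _ _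
  have hu₀ : u ≫ fst = 0 := pullback.lift_fst _ _ _
  have hιsnd : (kernel.ι fst ≫ snd) ≫ cokernel.π f = 0 := by
    rw [Category.assoc, ← hcomm, kernel.condition_assoc, zero_comp]
  have hy : kernel.ι fst = Abelian.monoLift f _ hιsnd ≫ u := by
    apply pullback.hom_ext
    · rw [← hfst, Category.assoc, hu₀, comp_zero, kernel.condition]
    · rw [← hsnd, Category.assoc, hu, Abelian.monoLift_comp]
  have hcancel : u ≫ (𝟙 _ - r ≫ u) = 0 := by
    rw [Preadditive.comp_sub, Category.comp_id, reassoc_of% hr, sub_self]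
  have hker : kernel.ι fst ≫ (𝟙 _ - r ≫ u) ≫ snd = 0 := by
    rw [hy, Category.assoc, reassoc_of% hcancel, zero_comp, comp_zero]
  refine ⟨Abelian.epiDesc fst _ hker, ?_⟩
  rw [← cancel_epi fst, Abelian.comp_epiDesc_assoc, hcomm]
  simp only [Preadditive.sub_comp, Category.assoc, Category.id_comp, reassoc_of% hu,
    cokernel.condition, comp_zero, sub_zero]

theorem epi_of_isSplitEpi_pullback_snd {M N X : C} (i : X ⟶ N) (g : M ⟶ N) [Epi g]
    (h : IsSplitEpi (pullback.snd i g)) : Epi i := by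
  obtain ⟨⟨σ, hσ⟩⟩ := h
  have hg : (σ ≫ pullback.fst i g) ≫ i = g := by
    rw [Category.assoc, pullback.condition, reassoc_of% hσ]
  exact epi_of_epi_fac hg

/-- A monomorphism whose cokernel projection has a section is a split monomorphism. -/
theorem isSplitMono_of_cokernel_section {L M : C} (f : L ⟶ M) [Mono f]
    (s : cokernel f ⟶ M) (hs : s ≫ cokernel.π f = 𝟙 _) : IsSplitMono f := by
  refine IsSplitMono.mk' ⟨Abelian.monoLift f (𝟙 M - cokernel.π f ≫ s) ?_, ?_⟩
  · simp [Preadditive.sub_comp, hs]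
  · rw [← cancel_mono f, Category.assoc, Abelian.monoLift_comp]
    simp [Preadditive.comp_sub]

end Abelian

section Modules

variable {A : Type} [Category.{0} A]

theorem app_injective_of_mono {X Y : A ⥤ ModuleCat.{0} k} (i : X ⟶ Y) [Mono i] (a : A) :
    Function.Injective (i.app a) :=
  (ModuleCat.mono_iff_injective _).1 inferInstance

theorem app_surjective_of_epi {X Y : A ⥤ ModuleCat.{0} k} (p : X ⟶ Y) [Epi p] (a : A) :
    Function.Surjective (p.app a) :=
  (ModuleCat.epi_iff_surjective _).1 inferInstance

/-- A morphism onto a locally finite-dimensional module splits as soon as it admits partial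
sections over a family of submodules containing every finite set of elements. -/
theorem exists_section_of_finite_sections {M N : A ⥤ ModuleCat.{0} k}
    (hM : ∀ a, FiniteDimensional k (M.obj a)) (hN : ∀ a, FiniteDimensional k (N.obj a))
    (g : M ⟶ N)
    (h : ∀ F : Finset (Σ a : A, N.obj a), ∃ (X : A ⥤ ModuleCat.{0} k) (i : X ⟶ N) (t : X ⟶ M),
      Mono i ∧ t ≫ g = i ∧ ∀ p ∈ F, ∃ x : X.obj p.1, i.app p.1 x = p.2) :
    ∃ s : N ⟶ M, s ≫ g = 𝟙 N := by
  classical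
  choose X i t hi ht hF using h
  let σ (a : A) (n : N.obj a) (F : Finset (Σ a : A, N.obj a)) : M.obj a :=
    if hx : ∃ x, (i F).app a x = n then (t F).app a hx.choose else 0
  have hσ : ∀ a F (x : (X F).obj a), σ a ((i F).app a x) F = (t F).app a x := by
    intro a F x
    have hx : ∃ y, (i F).app a y = (i F).app a x := ⟨x, rfl⟩
    have := hi F
    simp only [σ, dif_pos hx]
    rw [app_injective_of_mono (i F) a hx.choose_spec]
  have hev : ∀ a (n : N.obj a), ∀ᶠ F in Filter.atTop, ∃ x, (i F).app a x = n := by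
    intro a n
    filter_upwards [Filter.eventually_ge_atTop {⟨a, n⟩}] with F hn
    exact hF F ⟨a, n⟩ (hn (Finset.mem_singleton_self _))
  obtain ⟨lim, hlim⟩ := exists_linear_extension_eventual_value k
    (Filter.atTop : Filter (Finset (Σ a : A, N.obj a)))
  let s (a : A) : N.obj a →ₗ[k] M.obj a :=
    { toFun := fun n => vectorLim lim (M.obj a) (σ a n)
      map_add' := by
        intro m n
        refine vectorLim_add_of_eventually hlim ?_
        filter_upwards [hev a m, hev a n] with F ⟨x, hx⟩ ⟨y, hy⟩
        rw [← hx, ← hy, ← map_add, hσ, hσ, hσ, map_add]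
      map_smul' := by
        intro r n
        refine vectorLim_eq_of_eventually_map hlim (r • (LinearMap.id : M.obj a →ₗ[k] M.obj a)) ?_
        filter_upwards [hev a n] with F ⟨x, hx⟩
        rw [← hx, ← map_smul, hσ, hσ, map_smul]
        rfl }
  refine ⟨{ app := fun a => ModuleCat.ofHom (s a), naturality := ?_ }, ?_⟩
  · intro a b φ
    ext n
    refine vectorLim_eq_of_eventually_map hlim (M.map φ).hom ?_
    filter_upwards [hev a n] with F ⟨x, hx⟩
    have h₁ : N.map φ ((i F).app a x) = (i F).app b ((X F).map φ x) :=
      (NatTrans.naturality_apply (i F) φ x).symm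
    have h₂ : (t F).app b ((X F).map φ x) = M.map φ ((t F).app a x) :=
      NatTrans.naturality_apply (t F) φ x
    rw [← hx]
    change σ b (N.map φ ((i F).app a x)) F = M.map φ (σ a ((i F).app a x) F)
    rw [h₁, hσ, hσ, h₂]
  · ext a n
    change (g.app a).hom (vectorLim lim (M.obj a) (σ a n)) = n
    rw [← vectorLim_eq_of_eventually_map (V := M.obj a) (W := N.obj a) hlim (g.app a).hom
      (u := σ a n) (v := fun F => (g.app a).hom (σ a n F)) (.of_forall fun _ => rfl)]
    refine vectorLim_eq_of_eventually_const hlim ?_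
    filter_upwards [hev a n] with F ⟨x, hx⟩
    rw [← hx, hσ]
    conv_rhs => rw [← ht F]
    rfl

variable [Preadditive A] [CategoryTheory.Linear k A]

theorem IsLfdMod.of_mono {X Y : A ⥤ ModuleCat.{0} k} (hY : IsLfdMod k Y) (i : X ⟶ Y) [Mono i] :
    IsLfdMod k X := by
  refine ⟨⟨fun {a b} u v => ?_, fun {a b} r u => ?_⟩, fun a => ?_⟩
  · rw [← cancel_mono (i.app b), Preadditive.add_comp]
    simp only [i.naturality, hY.1.1, Preadditive.comp_add]
  · rw [← cancel_mono (i.app b), CategoryTheory.Linear.smul_comp]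
    simp only [i.naturality, hY.1.2, CategoryTheory.Linear.comp_smul]
  · have := hY.2 a
    exact FiniteDimensional.of_injective (i.app a).hom (app_injective_of_mono i a)

theorem IsLfdMod.of_epi {X Y : A ⥤ ModuleCat.{0} k} (hX : IsLfdMod k X) (p : X ⟶ Y) [Epi p] :
    IsLfdMod k Y := by
  refine ⟨⟨fun {a b} u v => ?_, fun {a b} r u => ?_⟩, fun a => ?_⟩
  · rw [← cancel_epi (p.app a), Preadditive.comp_add]
    simp only [← p.naturality, hX.1.1, Preadditive.add_comp]
  · rw [← cancel_epi (p.app a), CategoryTheory.Linear.comp_smul]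
    simp only [← p.naturality, hX.1.2, CategoryTheory.Linear.smul_comp]
  · have := hX.2 a
    exact Module.Finite.of_surjective (p.app a).hom (app_surjective_of_epi p a)

/-- The morphism `P_a ⟶ N` corresponding to an element of `N.obj a`. -/
noncomputable def ofElement {N : A ⥤ ModuleCat.{0} k} (hN : IsMod k N) {a : A} (n : N.obj a) :
    ProjAt k a ⟶ N where
  app b := ModuleCat.ofHom (X := (a ⟶ b))
    { toFun := fun φ => N.map φ n
      map_add' := fun φ ψ => by rw [hN.1]; rfl
      map_smul' := fun r φ => by rw [hN.2]; rfl }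
  naturality b c φ := by
    ext ψ
    exact ConcreteCategory.congr_hom (N.map_comp (X := a) ψ φ) n

theorem ofElement_app_id {N : A ⥤ ModuleCat.{0} k} (hN : IsMod k N) {a : A} (n : N.obj a) :
    ∃ x, (ofElement hN n).app a x = n := by
  refine ⟨(𝟙 a : a ⟶ a), ?_⟩
  change N.map (𝟙 a) n = n
  simp

/-- Every finite set of elements of a module lies in the image of a morphism from a finite direct
sum of projectives `P_a`. -/
theorem exists_biproduct_hom_through {N : A ⥤ ModuleCat.{0} k} (hN : IsMod k N)
    (F : Finset (Σ a : A, N.obj a)) :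
    ∃ (r : ℕ) (a : Fin r → A) (p : (⨁ fun i => ProjAt k (a i)) ⟶ N),
      ∀ q ∈ F, ∃ x, p.app q.1 x = q.2 := by
  let e : Fin F.card → Σ a : A, N.obj a := fun i => (F.equivFin.symm i).1
  refine ⟨F.card, fun i => (e i).1, biproduct.desc fun i => ofElement hN (e i).2, ?_⟩
  intro q hq
  obtain ⟨i, rfl⟩ : ∃ i, e i = q := ⟨F.equivFin ⟨q, hq⟩, by simp [e]⟩
  obtain ⟨x, hx⟩ := ofElement_app_id hN (e i).2
  refine ⟨(biproduct.ι (fun i => ProjAt k (e i).1) i).app _ x, ?_⟩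
  rw [← hx]
  conv_rhs => rw [← biproduct.ι_desc (fun i => ofElement hN (e i).2) i]
  rfl

/-- A submodule of the cokernel of an irreducible monomorphism either is the whole cokernel or
lifts to the middle term. -/
theorem Irred.epi_or_exists_lift {L M X : A ⥤ ModuleCat.{0} k} (hM : IsLfdMod k M) {f : L ⟶ M}
    [Mono f] (hirr : Irred k f) (i : X ⟶ cokernel f) [Mono i] :
    Epi i ∨ ∃ t : X ⟶ M, t ≫ cokernel.π f = i := by
  rcases hirr.2.2 (hM.of_mono (pullback.snd i (cokernel.π f)))
    (pullback.lift 0 f (by rw [zero_comp, cokernel.condition])) _ (pullback.lift_snd _ _ _)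
    with h | h
  · exact Or.inr (exists_lift_of_isSplitMono_pullback_lift f i h)
  · exact Or.inl (epi_of_isSplitEpi_pullback_snd i (cokernel.π f) h)

end Modules

end FinitelyGeneratedCokernel

variable (k : Type) [Field k] [IsAlgClosed k]
variable (A : Type) [Category.{0} A] [Preadditive A] [CategoryTheory.Linear k A]

/-- An irreducible monomorphism in `mod A` has finitely generated cokernel. -/
theorem statement_4 [Spectroid k A] {L M : A ⥤ ModuleCat.{0} k}
    (hL : IsLfdMod k L) (hM : IsLfdMod k M) (f : L ⟶ M) (hmono : Mono f)
    (hirr : Irred k f) :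
    IsFG k (cokernel f) := by
  have hN : IsLfdMod k (cokernel f) := hM.of_epi (cokernel.π f)
  by_contra hfg
  obtain ⟨s, hs⟩ := exists_section_of_finite_sections hM.2 hN.2 (cokernel.π f) fun F => by
    obtain ⟨r, a, p, hp⟩ := exists_biproduct_hom_through hN.1 F
    rcases hirr.epi_or_exists_lift hM (image.ι p) with hepi | ⟨t, ht⟩
    · refine absurd ⟨r, a, p, ?_⟩ hfg
      rw [← image.fac p]
      exact epi_comp _ _
    · refine ⟨image p, image.ι p, t, inferInstance, ht, fun q hq => ?_⟩
      obtain ⟨x, hx⟩ := hp q hq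
      refine ⟨(factorThruImage p).app q.1 x, ?_⟩
      rw [← hx]
      conv_rhs => rw [← image.fac p]
      rfl
  exact hirr.1 (isSplitMono_of_cokernel_section f s hs)

end Paper
end
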